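/- Let 𝔥 be a finite-dimensional semisimple Lie algebra over ℝ, let 𝔤 be a Lie subalgebra of 𝔥 that is a simple Lie algebra, and let V be a linear subspace of 𝔥 invariant under the adjoint action of 𝔤 such that 𝔥 = 𝔤 ⊕ V as vector spaces. Assume that V is irreducible as a 𝔤-module (V ≠ 0 and its only 𝔤-invariant subspaces are 0 and V), that V is not isomorphic to 𝔤 as a 𝔤-module (where 𝔤 acts on itself by the adjoint representation), and that ⁅𝔤, V⁆ ≠ 0. Then 𝔥 is a simple Lie algebra. -/

import Mathlib

/-- The projection onto a submodule along a complement commutes with the action of any element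
leaving both submodules invariant. -/
lemma Submodule.projection_lie {R L : Type*} [CommRing R] [LieRing L] [LieAlgebra R L]
    {A B : Submodule R L} (h : IsCompl A B) {x : L} (hA : ∀ a ∈ A, ⁅x, a⁆ ∈ A)
    (hB : ∀ b ∈ B, ⁅x, b⁆ ∈ B) (y : L) :
    A.projection B h ⁅x, y⁆ = ⁅x, A.projection B h y⁆ := by
  obtain ⟨a, ha, b, hb, rfl⟩ := Submodule.mem_sup.mp (h.sup_eq_top ▸ Submodule.mem_top : y ∈ A ⊔ B)
  rw [lie_add, map_add, map_add, Submodule.projection_apply_of_mem_left h ha,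
    Submodule.projection_apply_of_mem_left h (hA a ha), Submodule.projection_apply_of_mem_right h hb,
    Submodule.projection_apply_of_mem_right h (hB b hb), add_zero, add_zero]

namespace LieSubalgebra

variable {R L : Type*} [CommRing R] [LieRing L] [LieAlgebra R L] (𝔤 : LieSubalgebra R L)

/-- The submodule `A` is invariant under the adjoint action of `𝔤`, and contains no invariant
submodules except `⊥` and `A`. -/
structure IsInvariantMinimal (A : Submodule R L) : Prop where
  lie_mem : ∀ x ∈ 𝔤, ∀ a ∈ A, ⁅x, a⁆ ∈ A
  eq_bot_or_eq : ∀ W : Submodule R L, W ≤ A → (∀ x ∈ 𝔤, ∀ w ∈ W, ⁅x, w⁆ ∈ W) → W = ⊥ ∨ W = A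

lemma isInvariantMinimal_self [LieAlgebra.IsSimple R 𝔤] :
    𝔤.IsInvariantMinimal 𝔤.toSubmodule where
  lie_mem _ hx _ ha := 𝔤.lie_mem hx ha
  eq_bot_or_eq W hW hWinv := by
    let K : LieIdeal R 𝔤 :=
      { W.comap 𝔤.toSubmodule.subtype with
        lie_mem := fun {x m} hm ↦ hWinv x x.2 m hm }
    have hmem (y : 𝔤) : y ∈ K ↔ (y : L) ∈ W := Iff.rfl
    refine (LieAlgebra.IsSimple.eq_bot_or_eq_top K).imp (fun h ↦ ?_) fun h ↦ ?_
    · refine (Submodule.eq_bot_iff _).mpr fun w hw ↦ ?_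
      have : (⟨w, hW hw⟩ : 𝔤) ∈ K := hw
      rw [h, LieSubmodule.mem_bot] at this
      exact congrArg Subtype.val this
    · refine le_antisymm hW fun w hw ↦ (hmem ⟨w, hw⟩).mp ?_
      rw [h]
      exact LieSubmodule.mem_top _

variable {𝔤} {A B : Submodule R L}

/-- Schur's lemma for the adjoint action of a subalgebra. -/
lemma IsInvariantMinimal.eq_zero_or_exists_equiv (hA : 𝔤.IsInvariantMinimal A)
    (hB : 𝔤.IsInvariantMinimal B) (f : L →ₗ[R] L) (hf : ∀ x ∈ 𝔤, ∀ y, f ⁅x, y⁆ = ⁅x, f y⁆)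
    (hfAB : ∀ a ∈ A, f a ∈ B) :
    (∀ a ∈ A, f a = 0) ∨ ∃ e : A ≃ₗ[R] B, ∀ a : A, (e a : L) = f a := by
  rw [or_iff_not_imp_left]
  intro hne
  push Not at hne
  obtain ⟨a₀, ha₀, hfa₀⟩ := hne
  have hker : A ⊓ LinearMap.ker f = ⊥ := by
    refine (hA.eq_bot_or_eq _ inf_le_left fun x hx w hw ↦ ⟨hA.lie_mem x hx w hw.1, ?_⟩).resolve_right
      fun h ↦ hfa₀ ?_
    · rw [SetLike.mem_coe, LinearMap.mem_ker, hf x hx, LinearMap.mem_ker.mp hw.2, lie_zero]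
    · exact (h.ge ha₀).2
  have hmap : A.map f = B := by
    refine (hB.eq_bot_or_eq _ (Submodule.map_le_iff_le_comap.mpr hfAB) ?_).resolve_left fun h ↦ ?_
    · rintro x hx _ ⟨a, ha, rfl⟩
      exact ⟨⁅x, a⁆, hA.lie_mem x hx a ha, hf x hx a⟩
    · exact hfa₀ ((Submodule.mem_bot R).mp (h ▸ Submodule.mem_map_of_mem ha₀))
  refine ⟨LinearEquiv.ofBijective (f.restrict hfAB) ⟨?_, ?_⟩, fun _ ↦ rfl⟩
  · rw [← LinearMap.ker_eq_bot, LinearMap.ker_eq_bot']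
    intro a ha
    exact Subtype.ext ((Submodule.mem_bot R).mp (hker ▸ ⟨a.2, congrArg Subtype.val ha⟩))
  · rintro ⟨b, hb⟩
    obtain ⟨a, ha, rfl⟩ := hmap.ge hb
    exact ⟨⟨a, ha⟩, rfl⟩

/-- If the projection onto `I` along a complement `J` preserves a minimal invariant submodule, then
that submodule lies in `I` or in `J`. -/
lemma IsInvariantMinimal.le_or_le (hA : 𝔤.IsInvariantMinimal A) {I J : Submodule R L}
    (h : IsCompl I J) (hI : ∀ x ∈ 𝔤, ∀ y ∈ I, ⁅x, y⁆ ∈ I)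
    (hp : ∀ a ∈ A, I.projection J h a ∈ A) : A ≤ I ∨ A ≤ J := by
  rcases hA.eq_bot_or_eq (A ⊓ I) inf_le_left
    fun x hx w hw ↦ ⟨hA.lie_mem x hx w hw.1, hI x hx w hw.2⟩ with h0 | h0
  · refine Or.inr fun a ha ↦ (Submodule.projection_apply_eq_zero_iff h).mp ?_
    exact (Submodule.mem_bot R).mp (h0 ▸ ⟨hp a ha, Submodule.projection_apply_mem h a⟩)
  · exact Or.inl (inf_eq_left.mp h0)

/-- If `A` and `B` are complementary minimal invariant submodules which are not isomorphic, then
equivariant endomorphisms preserve `A`. -/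
lemma IsInvariantMinimal.apply_mem_of_isCompl (hA : 𝔤.IsInvariantMinimal A)
    (hB : 𝔤.IsInvariantMinimal B) (hAB : IsCompl A B)
    (hne : ¬ ∃ e : A ≃ₗ[R] B, ∀ x ∈ 𝔤, ∀ a a' : A, (a' : L) = ⁅x, (a : L)⁆ →
      (e a' : L) = ⁅x, (e a : L)⁆)
    (f : L →ₗ[R] L) (hf : ∀ x ∈ 𝔤, ∀ y, f ⁅x, y⁆ = ⁅x, f y⁆) {a : L} (ha : a ∈ A) : f a ∈ A := by
  have hcomm : ∀ x ∈ 𝔤, ∀ y, (B.projection A hAB.symm ∘ₗ f) ⁅x, y⁆ =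
      ⁅x, (B.projection A hAB.symm ∘ₗ f) y⁆ := fun x hx y ↦ by
    rw [LinearMap.comp_apply, hf x hx, Submodule.projection_lie hAB.symm (hB.lie_mem x hx)
      (hA.lie_mem x hx), LinearMap.comp_apply]
  rcases hA.eq_zero_or_exists_equiv hB _ hcomm
    fun _ _ ↦ Submodule.projection_apply_mem hAB.symm _ with h | ⟨e, he⟩
  · exact (Submodule.projection_apply_eq_zero_iff hAB.symm).mp (h a ha)
  · refine absurd ⟨e, fun x hx a a' haa' ↦ ?_⟩ hne
    rw [he, he, haa', hcomm x hx]

end LieSubalgebra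

/-- Let `𝔥` be a finite-dimensional semisimple real Lie algebra (trivial solvable
radical), `𝔤 ⊆ 𝔥` a Lie subalgebra that is a simple Lie algebra, and `V` a linear subspace of
`𝔥` invariant under the adjoint action of `𝔤` with `𝔥 = 𝔤 ⊕ V` as vector spaces.  If `V` is an
irreducible `𝔤`-module, `V` is not isomorphic to `𝔤` (with its adjoint action) as a `𝔤`-module,
and `⁅𝔤, V⁆ ≠ 0`, then `𝔥` is a simple Lie algebra. -/
theorem semisimple_with_irreducible_complement_is_simple
    (𝔥 : Type*) [LieRing 𝔥] [LieAlgebra ℝ 𝔥] [FiniteDimensional ℝ 𝔥]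
    (hss : LieAlgebra.radical ℝ 𝔥 = ⊥)
    (𝔤 : LieSubalgebra ℝ 𝔥) [LieAlgebra.IsSimple ℝ 𝔤]
    (V : Submodule ℝ 𝔥)
    (hVinv : ∀ x ∈ 𝔤, ∀ v ∈ V, ⁅x, v⁆ ∈ V)
    (hdisj : 𝔤.toSubmodule ⊓ V = ⊥)
    (hsup : 𝔤.toSubmodule ⊔ V = ⊤)
    (hV_ne : V ≠ ⊥)
    (hVirr : ∀ W : Submodule ℝ 𝔥, W ≤ V → (∀ x ∈ 𝔤, ∀ w ∈ W, ⁅x, w⁆ ∈ W) → W = ⊥ ∨ W = V)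
    (hnotiso : ¬ ∃ e : 𝔤 ≃ₗ[ℝ] V, ∀ x y : 𝔤,
      ((e ⁅x, y⁆ : V) : 𝔥) = ⁅(x : 𝔥), ((e y : V) : 𝔥)⁆)
    (hbracket_ne : ∃ x ∈ 𝔤, ∃ v ∈ V, ⁅x, v⁆ ≠ (0 : 𝔥)) :
    LieAlgebra.IsSimple ℝ 𝔥 := by
  have h𝔤 := 𝔤.isInvariantMinimal_self
  have hV : 𝔤.IsInvariantMinimal V := ⟨hVinv, hVirr⟩
  have h𝔤V : IsCompl 𝔤.toSubmodule V := IsCompl.of_eq hdisj hsup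
  obtain ⟨x₀, hx₀, v₀, hv₀, hxv⟩ := hbracket_ne
  have : LieAlgebra.HasTrivialRadical ℝ 𝔥 := ⟨hss⟩
  refine ⟨fun I ↦ ?_, fun h ↦ hxv (h.trivial x₀ v₀)⟩
  obtain ⟨J, hIJ⟩ := exists_isCompl I
  have hc : IsCompl I.toSubmodule J.toSubmodule := LieSubmodule.isCompl_toSubmodule.mpr hIJ
  have hI (x y : 𝔥) (hy : y ∈ I.toSubmodule) : ⁅x, y⁆ ∈ I.toSubmodule := I.lie_mem hy
  have hJ (x y : 𝔥) (hy : y ∈ J.toSubmodule) : ⁅x, y⁆ ∈ J.toSubmodule := J.lie_mem hy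
  have hp : ∀ x ∈ 𝔤, ∀ y, I.toSubmodule.projection J.toSubmodule hc ⁅x, y⁆ =
      ⁅x, I.toSubmodule.projection J.toSubmodule hc y⁆ :=
    fun x _ ↦ Submodule.projection_lie hc (hI x) (hJ x)
  have h𝔤IJ := h𝔤.le_or_le hc (fun x _ ↦ hI x) fun _ ↦
    h𝔤.apply_mem_of_isCompl hV h𝔤V (fun ⟨e, he⟩ ↦ hnotiso
      ⟨e, fun x y ↦ he x x.2 y ⁅x, y⁆ rfl⟩) _ hp
  have hVIJ := hV.le_or_le hc (fun x _ ↦ hI x) fun _ ↦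
    hV.apply_mem_of_isCompl h𝔤 h𝔤V.symm (fun ⟨e, he⟩ ↦ hnotiso ⟨e.symm, fun x y ↦ by
      have h := he x x.2 (e.symm y) ⟨_, hVinv x x.2 _ (e.symm y).2⟩ rfl
      rw [LinearEquiv.apply_symm_apply] at h
      have h' : e ⟨_, hVinv x x.2 _ (e.symm y).2⟩ = ⁅x, y⁆ := Subtype.ext h
      rw [← h']
      exact congrArg Subtype.val (e.symm_apply_apply _)⟩) _ hp
  rcases h𝔤IJ with h1 | h1 <;> rcases hVIJ with h2 | h2
  · right
    rw [← LieSubmodule.toSubmodule_eq_top, ← top_le_iff, ← hsup]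
    exact sup_le h1 h2
  · exact absurd ((Submodule.mem_bot ℝ).mp (hc.inf_eq_bot ▸
      ⟨lie_mem_left ℝ 𝔥 I x₀ v₀ (h1 hx₀), hJ x₀ v₀ (h2 hv₀)⟩)) hxv
  · exact absurd ((Submodule.mem_bot ℝ).mp (hc.inf_eq_bot ▸
      ⟨hI x₀ v₀ (h2 hv₀), lie_mem_left ℝ 𝔥 J x₀ v₀ (h1 hx₀)⟩)) hxv
  · left
    have hJtop : J = ⊤ := by
      rw [← LieSubmodule.toSubmodule_eq_top, ← top_le_iff, ← hsup]
      exact sup_le h1 h2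
    simpa [hJtop] using hIJ.inf_eq_bot
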